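/- Let W = {x ∈ ℝ³ : x_1 = 0}, let P ⊂ W be a triangle whose multiset of interior angles is one of the following four: {π/3, π/3, π/3}, {π/6, π/6, 2π/3}, {π/6, π/3, π/2}, {π/4, π/4, π/2}, and let C_P = {v + λ e_1 : v ∈ P, λ ∈ ℝ} be the corresponding two-sided infinite prism with boundary ∂C_P = {v + λ e_1 : v ∈ ∂P, λ ∈ ℝ}. Then there exists a function f : ℝ³ → ℝ that is harmonic on all of ℝ³, not identically zero, and vanishes at every point of ∂C_P. -/

import Mathlib

open Real EuclideanGeometry

/-- The second partial derivative of `f : ℝ³ → ℝ` in the `k`-th coordinate direction. -/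
noncomputable def secondPartial3 (f : EuclideanSpace ℝ (Fin 3) → ℝ) (k : Fin 3)
    (x : EuclideanSpace ℝ (Fin 3)) : ℝ :=
  fderiv ℝ (fun y => fderiv ℝ f y (EuclideanSpace.single k 1)) x (EuclideanSpace.single k 1)

/-- A function `f : ℝ³ → ℝ` is harmonic on all of `ℝ³` if it is smooth and its Laplacian
`Σ_{k=1}^3 ∂²f/∂x_k²` vanishes identically. -/
def IsHarmonic3 (f : EuclideanSpace ℝ (Fin 3) → ℝ) : Prop :=
  ContDiff ℝ (⊤ : ℕ∞) f ∧ ∀ x, ∑ k, secondPartial3 f k x = 0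

theorem IsHarmonic3.add {f g : EuclideanSpace ℝ (Fin 3) → ℝ} (hf : IsHarmonic3 f)
    (hg : IsHarmonic3 g) : IsHarmonic3 (fun x => f x + g x) := by
  refine ⟨hf.1.add hg.1, fun x => ?_⟩
  have key : ∀ k, secondPartial3 (fun x => f x + g x) k x
      = secondPartial3 f k x + secondPartial3 g k x := by
    intro k
    have hfd : Differentiable ℝ f := hf.1.differentiable (by simp)
    have hgd : Differentiable ℝ g := hg.1.differentiable (by simp)
    have hf2 : Differentiable ℝ (fun y => fderiv ℝ f y (EuclideanSpace.single k 1)) :=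
      ((hf.1.fderiv_right (m := 1) (by norm_cast)).clm_apply
        contDiff_const).differentiable (by simp)
    have hg2 : Differentiable ℝ (fun y => fderiv ℝ g y (EuclideanSpace.single k 1)) :=
      ((hg.1.fderiv_right (m := 1) (by norm_cast)).clm_apply
        contDiff_const).differentiable (by simp)
    unfold secondPartial3
    have : (fun y => fderiv ℝ (fun x => f x + g x) y (EuclideanSpace.single k 1))
        = fun y => fderiv ℝ f y (EuclideanSpace.single k 1)
          + fderiv ℝ g y (EuclideanSpace.single k 1) := by
      funext y
      rw [fderiv_fun_add (hfd y) (hgd y), add_apply]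
    rw [this, fderiv_fun_add (hf2 x) (hg2 x), add_apply]
  simp only [key, Finset.sum_add_distrib, hf.2 x, hg.2 x, add_zero]

theorem IsHarmonic3.const_mul {f : EuclideanSpace ℝ (Fin 3) → ℝ} (hf : IsHarmonic3 f) (a : ℝ) :
    IsHarmonic3 (fun x => a * f x) := by
  refine ⟨contDiff_const.mul hf.1, fun x => ?_⟩
  have key : ∀ k, secondPartial3 (fun x => a * f x) k x = a * secondPartial3 f k x := by
    intro k
    have hfd : Differentiable ℝ f := hf.1.differentiable (by simp)
    have hf2 : Differentiable ℝ (fun y => fderiv ℝ f y (EuclideanSpace.single k 1)) :=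
      ((hf.1.fderiv_right (m := 1) (by norm_cast)).clm_apply
        contDiff_const).differentiable (by simp)
    unfold secondPartial3
    have : (fun y => fderiv ℝ (fun x => a * f x) y (EuclideanSpace.single k 1))
        = fun y => a * fderiv ℝ f y (EuclideanSpace.single k 1) := by
      funext y
      rw [fderiv_const_mul (hfd y), smul_apply, smul_eq_mul]
    rw [this, fderiv_const_mul (hf2 x), smul_apply, smul_eq_mul]
  simp only [key, ← Finset.mul_sum, hf.2 x, mul_zero]

theorem fderiv_exp_mul_cos_add_sin (κ φ p q : ℝ) (k x e : EuclideanSpace ℝ (Fin 3)) :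
    fderiv ℝ (fun x : EuclideanSpace ℝ (Fin 3) =>
        exp (κ * x 0) * (p * cos (inner ℝ k x + φ) + q * sin (inner ℝ k x + φ))) x e
      = exp (κ * x 0) * ((p * κ * e 0 + q * inner ℝ k e) * cos (inner ℝ k x + φ)
        + (q * κ * e 0 - p * inner ℝ k e) * sin (inner ℝ k x + φ)) := by
  have h0 : HasFDerivAt (fun x : EuclideanSpace ℝ (Fin 3) => x 0)
      (EuclideanSpace.proj (0 : Fin 3) : EuclideanSpace ℝ (Fin 3) →L[ℝ] ℝ) x :=
    (EuclideanSpace.proj (0 : Fin 3) : EuclideanSpace ℝ (Fin 3) →L[ℝ] ℝ).hasFDerivAt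
  have hk : HasFDerivAt (fun x : EuclideanSpace ℝ (Fin 3) => inner ℝ k x + φ)
      (innerSL ℝ k) x := (innerSL ℝ k).hasFDerivAt.add_const φ
  have := ((h0.const_mul κ).exp).mul ((hk.cos.const_mul p).add (hk.sin.const_mul q))
  refine (congrArg (· e) this.fderiv).trans ?_
  simp
  ring

theorem isHarmonic3_exp_mul_cos {k : EuclideanSpace ℝ (Fin 3)} {κ : ℝ} (φ : ℝ) (hk : k 0 = 0)
    (hκ : κ ^ 2 = inner ℝ k k) :
    IsHarmonic3 (fun x => exp (κ * x 0) * cos (inner ℝ k x + φ)) := by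
  refine ⟨?_, fun x => ?_⟩
  · have : ContDiff ℝ (⊤ : ℕ∞) (innerSL ℝ k) := (innerSL ℝ k).contDiff
    simp only [← innerSL_apply_apply ℝ]
    fun_prop
  have key : ∀ i, secondPartial3 (fun x => exp (κ * x 0) * cos (inner ℝ k x + φ)) i x
      = exp (κ * x 0) * (((κ * (EuclideanSpace.single i (1 : ℝ) : EuclideanSpace ℝ (Fin 3)) 0) ^ 2
          - k i ^ 2) * cos (inner ℝ k x + φ)
        - 2 * κ * (EuclideanSpace.single i (1 : ℝ) : EuclideanSpace ℝ (Fin 3)) 0 * k i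
          * sin (inner ℝ k x + φ)) := by
    intro i
    have h1 (y) := fderiv_exp_mul_cos_add_sin κ φ 1 0 k y (EuclideanSpace.single i 1)
    simp only [one_mul, zero_mul, add_zero, zero_sub] at h1
    unfold secondPartial3
    simp only [h1]
    rw [fderiv_exp_mul_cos_add_sin]
    simp only [EuclideanSpace.inner_single_right, conj_trivial]
    ring
  have hn : κ ^ 2 = k 1 ^ 2 + k 2 ^ 2 := by
    rw [hκ, PiLp.inner_apply]
    simp [Fin.sum_univ_three, hk]
  simp only [key, Fin.sum_univ_three, hk]
  simp
  linear_combination exp (κ * x 0) * cos (inner ℝ k x + φ) * hn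

section PlaneWaves

variable {b c : EuclideanSpace ℝ (Fin 3)} {κ : ℝ}

theorem isHarmonic3_exp_mul_cos_of_coords (A : EuclideanSpace ℝ (Fin 3)) (hb : b 0 = 0)
    (hc : c 0 = 0) (m n φ : ℝ)
    (hκ : κ ^ 2 = m ^ 2 * inner ℝ b b + 2 * m * n * inner ℝ b c + n ^ 2 * inner ℝ c c) :
    IsHarmonic3 (fun x => exp (κ * x 0) *
      cos (m * inner ℝ b (x - A) + n * inner ℝ c (x - A) + φ)) := by
  have h := isHarmonic3_exp_mul_cos (k := m • b + n • c) (κ := κ)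
    (φ - m * inner ℝ b A - n * inner ℝ c A) (by simp [hb, hc]) (by
      rw [hκ]
      simp only [inner_add_left, inner_add_right, real_inner_smul_left, real_inner_smul_right,
        real_inner_comm b c]
      ring)
  convert h using 4
  simp only [inner_add_left, inner_sub_right, real_inner_smul_left]
  ring

theorem isHarmonic3_exp_mul_sin_of_coords (A : EuclideanSpace ℝ (Fin 3)) (hb : b 0 = 0)
    (hc : c 0 = 0) (m n : ℝ)
    (hκ : κ ^ 2 = m ^ 2 * inner ℝ b b + 2 * m * n * inner ℝ b c + n ^ 2 * inner ℝ c c) :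
    IsHarmonic3 (fun x => exp (κ * x 0) *
      sin (m * inner ℝ b (x - A) + n * inner ℝ c (x - A))) := by
  simpa only [← sub_eq_add_neg, cos_sub_pi_div_two] using
    isHarmonic3_exp_mul_cos_of_coords A hb hc m n (-(π / 2)) hκ

theorem isHarmonic3_exp_mul_sin_mul_sin_of_coords (A : EuclideanSpace ℝ (Fin 3)) (hb : b 0 = 0)
    (hc : c 0 = 0) (m n m' n' : ℝ)
    (horth : m * m' * inner ℝ b b + (m * n' + n * m') * inner ℝ b c
      + n * n' * inner ℝ c c = 0)
    (hκ : κ ^ 2 = (m ^ 2 + m' ^ 2) * inner ℝ b b + 2 * (m * n + m' * n') * inner ℝ b c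
      + (n ^ 2 + n' ^ 2) * inner ℝ c c) :
    IsHarmonic3 (fun x => exp (κ * x 0) *
      (sin (m * inner ℝ b (x - A) + n * inner ℝ c (x - A)) *
        sin (m' * inner ℝ b (x - A) + n' * inner ℝ c (x - A)))) := by
  have h₁ := isHarmonic3_exp_mul_cos_of_coords (κ := κ) A hb hc (m - m') (n - n') 0
    (by linear_combination hκ + 2 * horth)
  have h₂ := isHarmonic3_exp_mul_cos_of_coords (κ := κ) A hb hc (m + m') (n + n') 0
    (by linear_combination hκ - 2 * horth)
  convert (h₁.const_mul (1 / 2)).add (h₂.const_mul (-1 / 2)) using 2 with x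
  generalize inner ℝ b (x - A) = β
  generalize inner ℝ c (x - A) = γ
  rw [show (m - m') * β + (n - n') * γ + 0 = (m * β + n * γ) - (m' * β + n' * γ) by ring,
    show (m + m') * β + (n + n') * γ + 0 = (m * β + n * γ) + (m' * β + n' * γ) by ring,
    cos_sub, cos_add (m * β + n * γ)]
  ring

end PlaneWaves

/-- There is a nonzero entire harmonic function vanishing on the boundary of the prism over the
triangle `A B C`. -/
def PrismAdmitsHarmonic (A B C : EuclideanSpace ℝ (Fin 3)) : Prop :=
  ∃ f : EuclideanSpace ℝ (Fin 3) → ℝ, IsHarmonic3 f ∧ f ≠ 0 ∧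
    ∀ v ∈ segment ℝ A B ∪ segment ℝ B C ∪ segment ℝ C A, ∀ lam : ℝ,
      f (v + lam • EuclideanSpace.single (0 : Fin 3) (1 : ℝ)) = 0

theorem PrismAdmitsHarmonic.rotate {A B C : EuclideanSpace ℝ (Fin 3)}
    (h : PrismAdmitsHarmonic A B C) : PrismAdmitsHarmonic B C A := by
  obtain ⟨f, hf, h0, hv⟩ := h
  refine ⟨f, hf, h0, fun v hm => hv v ?_⟩
  simp only [Set.mem_union] at hm ⊢
  tauto

theorem PrismAdmitsHarmonic.swap {A B C : EuclideanSpace ℝ (Fin 3)}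
    (h : PrismAdmitsHarmonic A B C) : PrismAdmitsHarmonic A C B := by
  obtain ⟨f, hf, h0, hv⟩ := h
  refine ⟨f, hf, h0, fun v hm => hv v ?_⟩
  simp only [Set.mem_union, segment_symm ℝ C B, segment_symm ℝ A C, segment_symm ℝ B A] at hm ⊢
  tauto

theorem exists_dual_basis {u v : EuclideanSpace ℝ (Fin 3)} (hu : u 0 = 0) (hv : v 0 = 0)
    (hD : inner ℝ u u * inner ℝ v v - inner ℝ u v ^ 2 ≠ 0) :
    ∃ b c : EuclideanSpace ℝ (Fin 3), b 0 = 0 ∧ c 0 = 0 ∧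
      inner ℝ b u = 1 ∧ inner ℝ b v = 0 ∧ inner ℝ c u = 0 ∧ inner ℝ c v = 1 ∧
      inner ℝ b b = inner ℝ v v / (inner ℝ u u * inner ℝ v v - inner ℝ u v ^ 2) ∧
      inner ℝ b c = -inner ℝ u v / (inner ℝ u u * inner ℝ v v - inner ℝ u v ^ 2) ∧
      inner ℝ c c = inner ℝ u u / (inner ℝ u u * inner ℝ v v - inner ℝ u v ^ 2) := by
  set D := inner ℝ u u * inner ℝ v v - inner ℝ u v ^ 2 with hDdef
  refine ⟨(inner ℝ v v / D) • u - (inner ℝ u v / D) • v,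
    (inner ℝ u u / D) • v - (inner ℝ u v / D) • u, by simp [hu, hv], by simp [hu, hv], ?_⟩
  simp only [inner_sub_left, inner_sub_right, real_inner_smul_left, real_inner_smul_right,
    real_inner_comm u v]
  generalize inner ℝ u u = s at *
  generalize inner ℝ v v = t at *
  generalize inner ℝ u v = g at *
  refine ⟨?_, ?_, ?_, ?_, ?_, ?_, ?_⟩ <;> field_simp <;> rw [hDdef] <;> ring

/-- A profile `U` in affine coordinates relative to `A B C` that vanishes on the three side lines
gives a suitable function once `exp (κ x₀) U` is harmonic. -/
theorem prismAdmitsHarmonic_of_profile {A B C b c : EuclideanSpace ℝ (Fin 3)} {κ : ℝ}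
    (U : ℝ → ℝ → ℝ) (hb : b 0 = 0) (hc : c 0 = 0)
    (hbB : inner ℝ b (B - A) = 1) (hbC : inner ℝ b (C - A) = 0)
    (hcB : inner ℝ c (B - A) = 0) (hcC : inner ℝ c (C - A) = 1)
    (hU : IsHarmonic3 (fun x => exp (κ * x 0) * U (inner ℝ b (x - A)) (inner ℝ c (x - A))))
    (hAB : ∀ r, U r 0 = 0) (hAC : ∀ r, U 0 r = 0) (hBC : ∀ r, U r (1 - r) = 0)
    {x y : ℝ} (hxy : U x y ≠ 0) : PrismAdmitsHarmonic A B C := by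
  refine ⟨_, hU, fun h => ?_, ?_⟩
  · have := congrFun h (A + x • (B - A) + y • (C - A))
    simp only [Pi.zero_apply, mul_eq_zero, exp_ne_zero, false_or] at this
    refine hxy ?_
    rw [← this, show A + x • (B - A) + y • (C - A) - A = x • (B - A) + y • (C - A) by abel]
    simp [inner_add_right, real_inner_smul_right, hbB, hbC, hcB, hcC]
  · have hgen : ∀ p q lam : ℝ, U p q = 0 →
        exp (κ * (A + p • (B - A) + q • (C - A)
            + lam • EuclideanSpace.single (0 : Fin 3) (1 : ℝ)) 0)
          * U (inner ℝ b (A + p • (B - A) + q • (C - A)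
              + lam • EuclideanSpace.single (0 : Fin 3) (1 : ℝ) - A))
            (inner ℝ c (A + p • (B - A) + q • (C - A)
              + lam • EuclideanSpace.single (0 : Fin 3) (1 : ℝ) - A)) = 0 := by
      intro p q lam hpq
      rw [show A + p • (B - A) + q • (C - A) + lam • EuclideanSpace.single (0 : Fin 3) (1 : ℝ) - A
        = p • (B - A) + q • (C - A) + lam • EuclideanSpace.single (0 : Fin 3) (1 : ℝ) by abel]
      simp only [inner_add_right, real_inner_smul_right, hbB, hbC, hcB, hcC,
        EuclideanSpace.inner_single_right, hb, hc]
      simp [hpq]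
    rintro v ((hv | hv) | hv) lam <;> obtain ⟨p, q, -, -, hpq, rfl⟩ := hv
    · have := hgen q 0 lam (hAB q)
      rwa [show A + q • (B - A) + (0 : ℝ) • (C - A) = p • A + q • B by
        obtain rfl := eq_sub_of_add_eq hpq; module] at this
    · have := hgen p q lam (by rw [← hBC p, ← hpq, add_sub_cancel_left])
      rwa [show A + p • (B - A) + q • (C - A) = p • B + q • C by
        obtain rfl := eq_sub_of_add_eq hpq; module] at this
    · have := hgen 0 p lam (hAC p)
      rwa [show A + (0 : ℝ) • (B - A) + p • (C - A) = p • C + q • A by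
        obtain rfl := eq_sub_of_add_eq hpq; module] at this

theorem prismAdmitsHarmonic_of_equilateral_gram {A B C : EuclideanSpace ℝ (Fin 3)}
    (hA : A 0 = 0) (hB : B 0 = 0) (hC : C 0 = 0) (hs : inner ℝ (B - A) (B - A) ≠ 0)
    (hv : inner ℝ (C - A) (C - A) = inner ℝ (B - A) (B - A))
    (hg : inner ℝ (B - A) (C - A) = 1 / 2 * inner ℝ (B - A) (B - A)) :
    PrismAdmitsHarmonic A B C := by
  obtain ⟨b, c, hb, hc, h₁, h₂, h₃, h₄, hbb, hbc, hcc⟩ :=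
    exists_dual_basis (u := B - A) (v := C - A) (by simp [hA, hB]) (by simp [hA, hC]) (by
      rw [hv, hg]
      ring_nf
      simpa using hs)
  replace hcc : inner ℝ c c = inner ℝ b b := by rw [hcc, hbb, hv]
  replace hbc : inner ℝ b c = -(1 / 2) * inner ℝ b b := by rw [hbc, hbb, hv, hg]; ring
  have hκ : √((2 * π) ^ 2 * inner ℝ b b) ^ 2 = (2 * π) ^ 2 * inner ℝ b b :=
    sq_sqrt (mul_nonneg (sq_nonneg _) real_inner_self_nonneg)
  refine prismAdmitsHarmonic_of_profile (κ := √((2 * π) ^ 2 * inner ℝ b b))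
    (fun x y => sin (2 * π * x + 0 * y) + sin (0 * x + 2 * π * y)
      + (-1) * sin (2 * π * x + 2 * π * y)) hb hc h₁ h₂ h₃ h₄ ?_
    (fun r => ?_) (fun r => ?_) (fun r => ?_) (x := 1 / 4) (y := 1 / 4) ?_
  · convert ((isHarmonic3_exp_mul_sin_of_coords A hb hc (2 * π) 0 ?_).add
      (isHarmonic3_exp_mul_sin_of_coords A hb hc 0 (2 * π) ?_)).add
      ((isHarmonic3_exp_mul_sin_of_coords A hb hc (2 * π) (2 * π) ?_).const_mul (-1)) using 2
    · ring
    all_goals rw [hκ, hbc, hcc]; ring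
  · simp
  · simp
  · rw [show 0 * r + 2 * π * (1 - r) = 2 * π - 2 * π * r by ring,
      show 2 * π * r + 2 * π * (1 - r) = 2 * π by ring]
    simp
  · rw [show 2 * π * (1 / 4) + 0 * (1 / 4) = π / 2 by ring,
      show 0 * (1 / 4) + 2 * π * (1 / 4) = π / 2 by ring,
      show 2 * π * (1 / 4) + 2 * π * (1 / 4) = π by ring]
    norm_num

theorem prismAdmitsHarmonic_of_right_isosceles_gram {A B C : EuclideanSpace ℝ (Fin 3)}
    (hA : A 0 = 0) (hB : B 0 = 0) (hC : C 0 = 0) (hs : inner ℝ (B - A) (B - A) ≠ 0)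
    (hv : inner ℝ (C - A) (C - A) = inner ℝ (B - A) (B - A))
    (hg : inner ℝ (B - A) (C - A) = 0) :
    PrismAdmitsHarmonic A B C := by
  obtain ⟨b, c, hb, hc, h₁, h₂, h₃, h₄, hbb, hbc, hcc⟩ :=
    exists_dual_basis (u := B - A) (v := C - A) (by simp [hA, hB]) (by simp [hA, hC]) (by
      rw [hv, hg]
      simpa using hs)
  replace hcc : inner ℝ c c = inner ℝ b b := by rw [hcc, hbb, hv]
  replace hbc : inner ℝ b c = 0 := by rw [hbc, hg]; simp
  have hκ : √(5 * π ^ 2 * inner ℝ b b) ^ 2 = 5 * π ^ 2 * inner ℝ b b :=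
    sq_sqrt (mul_nonneg (by positivity) real_inner_self_nonneg)
  refine prismAdmitsHarmonic_of_profile (κ := √(5 * π ^ 2 * inner ℝ b b))
    (fun x y => sin (π * x + 0 * y) * sin (0 * x + 2 * π * y)
      + sin (2 * π * x + 0 * y) * sin (0 * x + π * y)) hb hc h₁ h₂ h₃ h₄ ?_
    (fun r => ?_) (fun r => ?_) (fun r => ?_) (x := 1 / 4) (y := 1 / 2) ?_
  · convert (isHarmonic3_exp_mul_sin_mul_sin_of_coords A hb hc π 0 0 (2 * π) ?_ ?_).add
      (isHarmonic3_exp_mul_sin_mul_sin_of_coords A hb hc (2 * π) 0 0 π ?_ ?_) using 2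
    · ring
    all_goals simp only [hκ, hbc, hcc]; ring
  · simp
  · simp
  · rw [show 0 * r + 2 * π * (1 - r) = 2 * π - 2 * π * r by ring,
      show 0 * r + π * (1 - r) = π - π * r by ring]
    simp
    ring
  · rw [show 2 * π * (1 / 4) + 0 * (1 / 2) = π / 2 by ring,
      show 0 * (1 / 4) + 2 * π * (1 / 2) = π by ring,
      show 0 * (1 / 4) + π * (1 / 2) = π / 2 by ring]
    norm_num

theorem sin_three_mul_sin_add_sin_mul_sin_five (p : ℝ) :
    sin (3 * p) * sin p + sin p * sin (5 * p) = sin (2 * p) * sin (4 * p) := by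
  have h₁ := cos_sub (3 * p) p
  have h₂ := cos_add (3 * p) p
  have h₃ := cos_sub (5 * p) p
  have h₄ := cos_add (5 * p) p
  have h₅ := cos_sub (4 * p) (2 * p)
  have h₆ := cos_add (4 * p) (2 * p)
  ring_nf at h₁ h₂ h₃ h₄ h₅ h₆ ⊢
  linarith

theorem prismAdmitsHarmonic_of_half_equilateral_gram {A B C : EuclideanSpace ℝ (Fin 3)}
    (hA : A 0 = 0) (hB : B 0 = 0) (hC : C 0 = 0) (hs : inner ℝ (B - A) (B - A) ≠ 0)
    (hv : inner ℝ (C - A) (C - A) = 3 * inner ℝ (B - A) (B - A))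
    (hg : inner ℝ (B - A) (C - A) = 0) :
    PrismAdmitsHarmonic A B C := by
  obtain ⟨b, c, hb, hc, h₁, h₂, h₃, h₄, hbb, hbc, hcc⟩ :=
    exists_dual_basis (u := B - A) (v := C - A) (by simp [hA, hB]) (by simp [hA, hC]) (by
      rw [hv, hg]
      simpa using hs)
  replace hbb : inner ℝ b b = 3 * inner ℝ c c := by rw [hcc, hbb, hv]; ring
  replace hbc : inner ℝ b c = 0 := by rw [hbc, hg]; simp
  have hκ : √(28 * π ^ 2 * inner ℝ c c) ^ 2 = 28 * π ^ 2 * inner ℝ c c :=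
    sq_sqrt (mul_nonneg (by positivity) real_inner_self_nonneg)
  refine prismAdmitsHarmonic_of_profile (κ := √(28 * π ^ 2 * inner ℝ c c))
    (fun x y => sin (3 * π * x + 0 * y) * sin (0 * x + π * y)
      + sin (π * x + 0 * y) * sin (0 * x + 5 * π * y)
      + sin (2 * π * x + 0 * y) * sin (0 * x + 4 * π * y)) hb hc h₁ h₂ h₃ h₄ ?_
    (fun r => ?_) (fun r => ?_) (fun r => ?_) (x := 1 / 4) (y := 1 / 2) ?_
  · convert ((isHarmonic3_exp_mul_sin_mul_sin_of_coords A hb hc (3 * π) 0 0 π ?_ ?_).add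
      (isHarmonic3_exp_mul_sin_mul_sin_of_coords A hb hc π 0 0 (5 * π) ?_ ?_)).add
      (isHarmonic3_exp_mul_sin_mul_sin_of_coords A hb hc (2 * π) 0 0 (4 * π) ?_ ?_) using 2
    · ring
    all_goals simp only [hκ, hbc, hbb]; ring
  · simp
  · simp
  · have key := sin_three_mul_sin_add_sin_mul_sin_five (π * r)
    have e₁ : sin (0 * r + π * (1 - r)) = sin (π * r) := by
      rw [← sin_pi_sub]; ring_nf
    have e₂ : sin (0 * r + 5 * π * (1 - r)) = sin (5 * (π * r)) := by
      rw [← sin_pi_sub, ← sin_add_nat_mul_two_pi _ 2]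
      push_cast
      ring_nf
    have e₃ : sin (0 * r + 4 * π * (1 - r)) = -sin (4 * (π * r)) := by
      rw [← sin_neg, ← sin_add_nat_mul_two_pi (-(4 * (π * r))) 2]
      push_cast
      ring_nf
    rw [e₁, e₂, e₃]
    ring_nf at key ⊢
    linarith
  · rw [show 3 * π * (1 / 4) + 0 * (1 / 2) = π - π / 4 by ring,
      show π * (1 / 4) + 0 * (1 / 2) = π / 4 by ring,
      show 0 * (1 / 4) + π * (1 / 2) = π / 2 by ring,
      show 0 * (1 / 4) + 5 * π * (1 / 2) = π / 2 + 2 * π by ring,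
      show 0 * (1 / 4) + 4 * π * (1 / 2) = 2 * π by ring,
      sin_pi_sub, sin_add_two_pi, sin_pi_div_four]
    simp

theorem prismAdmitsHarmonic_of_obtuse_gram {A B C : EuclideanSpace ℝ (Fin 3)}
    (hA : A 0 = 0) (hB : B 0 = 0) (hC : C 0 = 0) (hs : inner ℝ (B - A) (B - A) ≠ 0)
    (hv : inner ℝ (C - A) (C - A) = inner ℝ (B - A) (B - A))
    (hg : inner ℝ (B - A) (C - A) = -(1 / 2) * inner ℝ (B - A) (B - A)) :
    PrismAdmitsHarmonic A B C := by
  obtain ⟨b, c, hb, hc, h₁, h₂, h₃, h₄, hbb, hbc, hcc⟩ :=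
    exists_dual_basis (u := B - A) (v := C - A) (by simp [hA, hB]) (by simp [hA, hC]) (by
      rw [hv, hg]
      ring_nf
      simpa using hs)
  replace hcc : inner ℝ c c = inner ℝ b b := by rw [hcc, hbb, hv]
  replace hbc : inner ℝ b c = 1 / 2 * inner ℝ b b := by rw [hbc, hbb, hv, hg]; ring
  have hκ : √(28 * π ^ 2 * inner ℝ b b) ^ 2 = 28 * π ^ 2 * inner ℝ b b :=
    sq_sqrt (mul_nonneg (by positivity) real_inner_self_nonneg)
  refine prismAdmitsHarmonic_of_profile (κ := √(28 * π ^ 2 * inner ℝ b b))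
    (fun x y => sin (3 * π * x + 3 * π * y) * sin (π * x + -π * y)
      + sin (π * x + π * y) * sin (5 * π * x + -(5 * π) * y)
      + (-1) * (sin (2 * π * x + 2 * π * y) * sin (4 * π * x + -(4 * π) * y)))
    hb hc h₁ h₂ h₃ h₄ ?_
    (fun r => ?_) (fun r => ?_) (fun r => ?_) (x := 3 / 8) (y := -1 / 8) ?_
  · convert ((isHarmonic3_exp_mul_sin_mul_sin_of_coords A hb hc (3 * π) (3 * π) π (-π) ?_ ?_).add
      (isHarmonic3_exp_mul_sin_mul_sin_of_coords A hb hc π π (5 * π) (-(5 * π)) ?_ ?_)).add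
      ((isHarmonic3_exp_mul_sin_mul_sin_of_coords A hb hc (2 * π) (2 * π) (4 * π) (-(4 * π))
        ?_ ?_).const_mul (-1)) using 2
    · ring
    all_goals simp only [hκ, hbc, hcc]; ring
  · have key := sin_three_mul_sin_add_sin_mul_sin_five (π * r)
    ring_nf at key ⊢
    linarith
  · have key := sin_three_mul_sin_add_sin_mul_sin_five (π * r)
    simp only [mul_zero, zero_add, neg_mul, sin_neg]
    ring_nf at key ⊢
    linarith
  · rw [show 3 * π * r + 3 * π * (1 - r) = π + 2 * π by ring,
      show π * r + π * (1 - r) = π by ring, show 2 * π * r + 2 * π * (1 - r) = 2 * π by ring,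
      sin_add_two_pi]
    simp
  · rw [show 3 * π * (3 / 8) + 3 * π * (-1 / 8) = π - π / 4 by ring,
      show π * (3 / 8) + π * (-1 / 8) = π / 4 by ring,
      show π * (3 / 8) + -π * (-1 / 8) = π / 2 by ring,
      show 5 * π * (3 / 8) + -(5 * π) * (-1 / 8) = π / 2 + 2 * π by ring,
      show 4 * π * (3 / 8) + -(4 * π) * (-1 / 8) = 2 * π by ring,
      sin_pi_sub, sin_add_two_pi, sin_pi_div_four]
    simp

theorem gram_of_angle_of_base_angles_eq {A B C : EuclideanSpace ℝ (Fin 3)}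
    (hBC : ∠ A B C = ∠ A C B)
    (hpi : ∠ B A C ≠ π) :
    inner ℝ (C - A) (C - A) = inner ℝ (B - A) (B - A) ∧
      inner ℝ (B - A) (C - A) = cos (∠ B A C) * inner ℝ (B - A) (B - A) := by
  have h : ‖C - A‖ = ‖B - A‖ := by
    rw [← dist_eq_norm, ← dist_eq_norm, dist_comm C, dist_comm B]
    exact (dist_eq_of_angle_eq_angle_of_angle_ne_pi hBC hpi).symm
  refine ⟨by rw [real_inner_self_eq_norm_mul_norm, real_inner_self_eq_norm_mul_norm, h], ?_⟩
  rw [← InnerProductGeometry.cos_angle_mul_norm_mul_norm, real_inner_self_eq_norm_mul_norm, h]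
  rfl

theorem gram_of_half_equilateral_angles {A B C : EuclideanSpace ℝ (Fin 3)} (hA : ∠ B A C = π / 2)
    (hB : ∠ A B C = π / 3) (hAB : A ≠ B) :
    inner ℝ (C - A) (C - A) = 3 * inner ℝ (B - A) (B - A) ∧ inner ℝ (B - A) (C - A) = 0 := by
  refine ⟨?_, InnerProductGeometry.inner_eq_zero_iff_angle_eq_pi_div_two _ _ |>.2 hA⟩
  have h := tan_angle_mul_dist_of_angle_eq_pi_div_two (p₁ := C) (p₂ := A) (p₃ := B)
    (by rwa [angle_comm]) (Or.inr hAB.symm)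
  rw [hB, tan_pi_div_three, dist_eq_norm, dist_eq_norm] at h
  rw [real_inner_self_eq_norm_mul_norm, real_inner_self_eq_norm_mul_norm, ← h]
  linear_combination ‖B - A‖ ^ 2 * sq_sqrt (show (0 : ℝ) ≤ 3 by norm_num)

theorem multiset_triple_eq {α : Type*} {a b c x y z : α}
    (h : ({a, b, c} : Multiset α) = {x, y, z}) :
    (a = x ∧ b = y ∧ c = z) ∨ (a = x ∧ b = z ∧ c = y) ∨ (a = y ∧ b = x ∧ c = z) ∨
      (a = y ∧ b = z ∧ c = x) ∨ (a = z ∧ b = x ∧ c = y) ∨ (a = z ∧ b = y ∧ c = x) := by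
  have h' : ({a, b, c} : Multiset α) = ((([x, y, z] : List α)) : Multiset α) := h
  have : ([a, b, c] : List α) ∈ ([x, y, z] : List α).permutations := by
    rw [List.mem_permutations]
    exact Multiset.coe_eq_coe.1 h'
  simp [List.permutations, List.permutationsAux, List.permutationsAux.rec] at this
  tauto

section Angles

variable {A B C : EuclideanSpace ℝ (Fin 3)}

theorem prismAdmitsHarmonic_of_isosceles (hA : A 0 = 0) (hB : B 0 = 0) (hC : C 0 = 0)
    (hAB : A ≠ B) (hBC : ∠ A B C = ∠ A C B)
    (hang : ∠ B A C = π / 3 ∨ ∠ B A C = π / 2 ∨ ∠ B A C = 2 * π / 3) :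
    PrismAdmitsHarmonic A B C := by
  have hs : inner ℝ (B - A) (B - A) ≠ 0 := inner_self_ne_zero.2 (sub_ne_zero.2 hAB.symm)
  have hpi := pi_pos
  obtain ⟨hv, hg⟩ := gram_of_angle_of_base_angles_eq hBC (by
    rcases hang with h | h | h <;> rw [h] <;> intro h' <;> linarith)
  rcases hang with h | h | h
  · exact prismAdmitsHarmonic_of_equilateral_gram hA hB hC hs hv (by
      rw [hg, h, cos_pi_div_three])
  · exact prismAdmitsHarmonic_of_right_isosceles_gram hA hB hC hs hv (by
      rw [hg, h, cos_pi_div_two, zero_mul])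
  · exact prismAdmitsHarmonic_of_obtuse_gram hA hB hC hs hv (by
      rw [hg, h, show 2 * π / 3 = π - π / 3 by ring, cos_pi_sub, cos_pi_div_three])

theorem prismAdmitsHarmonic_of_half_equilateral (hA : A 0 = 0) (hB : B 0 = 0) (hC : C 0 = 0)
    (hAB : A ≠ B) (h : ∠ B A C = π / 2) (h' : ∠ A B C = π / 3) :
    PrismAdmitsHarmonic A B C :=
  have ⟨hv, hg⟩ := gram_of_half_equilateral_angles h h' hAB
  prismAdmitsHarmonic_of_half_equilateral_gram hA hB hC
    (inner_self_ne_zero.2 (sub_ne_zero.2 hAB.symm)) hv hg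

end Angles

/-- Let `P ⊂ W = {x₁ = 0}` be a nondegenerate triangle with vertices `A, B, C` whose
multiset of interior angles is one of `{π/3,π/3,π/3}`, `{π/6,π/6,2π/3}`, `{π/6,π/3,π/2}`,
`{π/4,π/4,π/2}`. Then there exists a nonzero entire harmonic function on `ℝ³` vanishing
on the boundary `∂C_P = {v + λe₁ : v ∈ ∂P, λ ∈ ℝ}` of the two-sided infinite prism over
`P`. -/
theorem exists_harmonic_vanishing_on_prism_boundary
    (A B C : EuclideanSpace ℝ (Fin 3))
    (hA : A 0 = 0) (hB : B 0 = 0) (hC : C 0 = 0)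
    (hnc : ¬ Collinear ℝ ({A, B, C} : Set (EuclideanSpace ℝ (Fin 3))))
    (hangles : ({∠ B A C, ∠ A B C, ∠ A C B} : Multiset ℝ) ∈
      ({{π / 3, π / 3, π / 3}, {π / 6, π / 6, 2 * π / 3},
        {π / 6, π / 3, π / 2}, {π / 4, π / 4, π / 2}} : Set (Multiset ℝ))) :
    ∃ f : EuclideanSpace ℝ (Fin 3) → ℝ, IsHarmonic3 f ∧ f ≠ 0 ∧
      ∀ v ∈ segment ℝ A B ∪ segment ℝ B C ∪ segment ℝ C A, ∀ lam : ℝ,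
        f (v + lam • EuclideanSpace.single (0 : Fin 3) (1 : ℝ)) = 0 := by
  have hAB : A ≠ B := ne₁₂_of_not_collinear hnc
  have hAC : A ≠ C := ne₁₃_of_not_collinear hnc
  have hBC : B ≠ C := ne₂₃_of_not_collinear hnc
  change PrismAdmitsHarmonic A B C
  have isoA := prismAdmitsHarmonic_of_isosceles hA hB hC hAB
  have isoB := fun h h' =>
    (prismAdmitsHarmonic_of_isosceles hB hC hA hBC h h').rotate.rotate
  have isoC := fun h h' => (prismAdmitsHarmonic_of_isosceles hC hA hB hAC.symm h h').rotate
  have halfAB := prismAdmitsHarmonic_of_half_equilateral hA hB hC hAB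
  have halfAC := fun h h' => (prismAdmitsHarmonic_of_half_equilateral hA hC hB hAC h h').swap
  have halfBC := fun h h' =>
    (prismAdmitsHarmonic_of_half_equilateral hB hC hA hBC h h').rotate.rotate
  have halfBA := fun h h' =>
    (prismAdmitsHarmonic_of_half_equilateral hB hA hC hAB.symm h h').swap.rotate.rotate
  have halfCA := fun h h' =>
    (prismAdmitsHarmonic_of_half_equilateral hC hA hB hAC.symm h h').rotate
  have halfCB := fun h h' =>
    (prismAdmitsHarmonic_of_half_equilateral hC hB hA hBC.symm h h').swap.rotate
  simp only [angle_comm C B A, angle_comm C A B, angle_comm B C A]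
    at isoB isoC halfAC halfBC halfBA halfCA halfCB
  simp only [Set.mem_insert_iff, Set.mem_singleton_iff] at hangles
  rcases hangles with h | h | h | h <;>
    rcases multiset_triple_eq h with h | h | h | h | h | h <;>
    obtain ⟨h₁, h₂, h₃⟩ := h <;>
    simp only [h₁, h₂, h₃, true_or, or_true, forall_const] at * <;>
    assumption
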